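/- In an Ann-category 𝒜, the canonical zero isomorphisms at the ⊗-unit agree with the ⊗-unit constraints: L̂^1 = l_0 : 1 ⊗ 0 → 0 and R̂^1 = r_0 : 0 ⊗ 1 → 0. (These are axioms K14 and K13 of a ring category.) -/

import Mathlib

open CategoryTheory

universe v u

/-- An Ann-category: a groupoid with a symmetric monoidal (Picard) structure `⊕`
(`add`, constraints `aPlus`, `csym`, unit `zero` with `gl`, `dr`), a monoidal
structure `⊗` (`mul`, constraint `aMul`, unit `one` with `lu`, `ru`), and
distributivity isomorphisms `distL` (𝔏) and `distR` (ℜ) satisfying (Ann-1),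
(Ann-2) and (Ann-3). -/
structure AnnCat (C : Type u) [Groupoid.{v} C] where
  add : C → C → C
  addHom : ∀ {X₁ Y₁ X₂ Y₂ : C}, (X₁ ⟶ Y₁) → (X₂ ⟶ Y₂) → (add X₁ X₂ ⟶ add Y₁ Y₂)
  addHom_id : ∀ (X Y : C), addHom (𝟙 X) (𝟙 Y) = 𝟙 (add X Y)
  addHom_comp : ∀ {X₁ Y₁ Z₁ X₂ Y₂ Z₂ : C} (f₁ : X₁ ⟶ Y₁) (g₁ : Y₁ ⟶ Z₁)
    (f₂ : X₂ ⟶ Y₂) (g₂ : Y₂ ⟶ Z₂),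
    addHom (f₁ ≫ g₁) (f₂ ≫ g₂) = addHom f₁ f₂ ≫ addHom g₁ g₂
  zero : C
  aPlus : ∀ (X Y Z : C), add X (add Y Z) ≅ add (add X Y) Z
  aPlus_natural : ∀ {X X' Y Y' Z Z' : C} (f : X ⟶ X') (g : Y ⟶ Y') (h : Z ⟶ Z'),
    addHom f (addHom g h) ≫ (aPlus X' Y' Z').hom
      = (aPlus X Y Z).hom ≫ addHom (addHom f g) h
  csym : ∀ (X Y : C), add X Y ≅ add Y X
  csym_natural : ∀ {X X' Y Y' : C} (f : X ⟶ X') (g : Y ⟶ Y'),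
    addHom f g ≫ (csym X' Y').hom = (csym X Y).hom ≫ addHom g f
  csym_symm : ∀ (X Y : C), (csym X Y).hom ≫ (csym Y X).hom = 𝟙 (add X Y)
  gl : ∀ (X : C), add zero X ≅ X
  gl_natural : ∀ {X Y : C} (f : X ⟶ Y), addHom (𝟙 zero) f ≫ (gl Y).hom = (gl X).hom ≫ f
  dr : ∀ (X : C), add X zero ≅ X
  dr_natural : ∀ {X Y : C} (f : X ⟶ Y), addHom f (𝟙 zero) ≫ (dr Y).hom = (dr X).hom ≫ f
  add_pentagon : ∀ (W X Y Z : C),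
    addHom (𝟙 W) (aPlus X Y Z).hom ≫ (aPlus W (add X Y) Z).hom
        ≫ addHom (aPlus W X Y).hom (𝟙 Z)
      = (aPlus W X (add Y Z)).hom ≫ (aPlus (add W X) Y Z).hom
  add_triangle : ∀ (X Y : C),
    (aPlus X zero Y).hom ≫ addHom (dr X).hom (𝟙 Y) = addHom (𝟙 X) (gl Y).hom
  add_hexagon : ∀ (X Y Z : C),
    (aPlus X Y Z).hom ≫ (csym (add X Y) Z).hom ≫ (aPlus Z X Y).hom
      = addHom (𝟙 X) (csym Y Z).hom ≫ (aPlus X Z Y).hom ≫ addHom (csym X Z).hom (𝟙 Y)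
  add_inv : ∀ X : C, ∃ X' : C, Nonempty (add X X' ≅ zero)
  mul : C → C → C
  mulHom : ∀ {X₁ Y₁ X₂ Y₂ : C}, (X₁ ⟶ Y₁) → (X₂ ⟶ Y₂) → (mul X₁ X₂ ⟶ mul Y₁ Y₂)
  mulHom_id : ∀ (X Y : C), mulHom (𝟙 X) (𝟙 Y) = 𝟙 (mul X Y)
  mulHom_comp : ∀ {X₁ Y₁ Z₁ X₂ Y₂ Z₂ : C} (f₁ : X₁ ⟶ Y₁) (g₁ : Y₁ ⟶ Z₁)
    (f₂ : X₂ ⟶ Y₂) (g₂ : Y₂ ⟶ Z₂),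
    mulHom (f₁ ≫ g₁) (f₂ ≫ g₂) = mulHom f₁ f₂ ≫ mulHom g₁ g₂
  one : C
  aMul : ∀ (X Y Z : C), mul X (mul Y Z) ≅ mul (mul X Y) Z
  aMul_natural : ∀ {X X' Y Y' Z Z' : C} (f : X ⟶ X') (g : Y ⟶ Y') (h : Z ⟶ Z'),
    mulHom f (mulHom g h) ≫ (aMul X' Y' Z').hom
      = (aMul X Y Z).hom ≫ mulHom (mulHom f g) h
  lu : ∀ (X : C), mul one X ≅ X
  lu_natural : ∀ {X Y : C} (f : X ⟶ Y), mulHom (𝟙 one) f ≫ (lu Y).hom = (lu X).hom ≫ f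
  ru : ∀ (X : C), mul X one ≅ X
  ru_natural : ∀ {X Y : C} (f : X ⟶ Y), mulHom f (𝟙 one) ≫ (ru Y).hom = (ru X).hom ≫ f
  mul_pentagon : ∀ (W X Y Z : C),
    mulHom (𝟙 W) (aMul X Y Z).hom ≫ (aMul W (mul X Y) Z).hom
        ≫ mulHom (aMul W X Y).hom (𝟙 Z)
      = (aMul W X (mul Y Z)).hom ≫ (aMul (mul W X) Y Z).hom
  mul_triangle : ∀ (X Y : C),
    (aMul X one Y).hom ≫ mulHom (ru X).hom (𝟙 Y) = mulHom (𝟙 X) (lu Y).hom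
  distL : ∀ (A X Y : C), mul A (add X Y) ≅ add (mul A X) (mul A Y)
  distL_natural : ∀ {A A' X X' Y Y' : C} (f : A ⟶ A') (u : X ⟶ X') (w : Y ⟶ Y'),
    mulHom f (addHom u w) ≫ (distL A' X' Y').hom
      = (distL A X Y).hom ≫ addHom (mulHom f u) (mulHom f w)
  distR : ∀ (X Y A : C), mul (add X Y) A ≅ add (mul X A) (mul Y A)
  distR_natural : ∀ {X X' Y Y' A A' : C} (u : X ⟶ X') (w : Y ⟶ Y') (f : A ⟶ A'),
    mulHom (addHom u w) f ≫ (distR X' Y' A').hom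
      = (distR X Y A).hom ≫ addHom (mulHom u f) (mulHom w f)
  -- (Ann-1): (A ⊗ −, 𝔏) and (− ⊗ A, ℜ) are ⊕-functors compatible with a⁺ and c
  distL_aPlus : ∀ (A X Y Z : C),
    mulHom (𝟙 A) (aPlus X Y Z).hom ≫ (distL A (add X Y) Z).hom
        ≫ addHom (distL A X Y).hom (𝟙 (mul A Z))
      = (distL A X (add Y Z)).hom ≫ addHom (𝟙 (mul A X)) (distL A Y Z).hom
        ≫ (aPlus (mul A X) (mul A Y) (mul A Z)).hom
  distL_csym : ∀ (A X Y : C),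
    mulHom (𝟙 A) (csym X Y).hom ≫ (distL A Y X).hom
      = (distL A X Y).hom ≫ (csym (mul A X) (mul A Y)).hom
  distR_aPlus : ∀ (X Y Z A : C),
    mulHom (aPlus X Y Z).hom (𝟙 A) ≫ (distR (add X Y) Z A).hom
        ≫ addHom (distR X Y A).hom (𝟙 (mul Z A))
      = (distR X (add Y Z) A).hom ≫ addHom (𝟙 (mul X A)) (distR Y Z A).hom
        ≫ (aPlus (mul X A) (mul Y A) (mul Z A)).hom
  distR_csym : ∀ (X Y A : C),
    mulHom (csym X Y).hom (𝟙 A) ≫ (distR Y X A).hom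
      = (distR X Y A).hom ≫ (csym (mul X A) (mul Y A)).hom
  -- (Ann-2)
  ann11 : ∀ (A B X Y : C),
    mulHom (𝟙 A) (distL B X Y).hom ≫ (distL A (mul B X) (mul B Y)).hom
        ≫ addHom (aMul A B X).hom (aMul A B Y).hom
      = (aMul A B (add X Y)).hom ≫ (distL (mul A B) X Y).hom
  ann11' : ∀ (X Y B A : C),
    (aMul (add X Y) B A).hom ≫ mulHom (distR X Y B).hom (𝟙 A)
        ≫ (distR (mul X B) (mul Y B) A).hom
      = (distR X Y (mul B A)).hom ≫ addHom (aMul X B A).hom (aMul Y B A).hom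
  ann12 : ∀ (A X Y B : C),
    (aMul A (add X Y) B).hom ≫ mulHom (distL A X Y).hom (𝟙 B)
        ≫ (distR (mul A X) (mul A Y) B).hom
      = mulHom (𝟙 A) (distR X Y B).hom ≫ (distL A (mul X B) (mul Y B)).hom
        ≫ addHom (aMul A X B).hom (aMul A Y B).hom
  ann13 : ∀ (A B X Y : C),
    (distL (add A B) X Y).hom ≫ addHom (distR A B X).hom (distR A B Y).hom
        ≫ ((aPlus (add (mul A X) (mul B X)) (mul A Y) (mul B Y)).hom
          ≫ addHom (aPlus (mul A X) (mul B X) (mul A Y)).inv (𝟙 (mul B Y))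
          ≫ addHom (addHom (𝟙 (mul A X)) (csym (mul B X) (mul A Y)).hom) (𝟙 (mul B Y))
          ≫ addHom (aPlus (mul A X) (mul A Y) (mul B X)).hom (𝟙 (mul B Y))
          ≫ (aPlus (add (mul A X) (mul A Y)) (mul B X) (mul B Y)).inv)
      = (distR A B (add X Y)).hom ≫ addHom (distL A X Y).hom (distL B X Y).hom
  -- (Ann-3)
  ann3l : ∀ (X Y : C),
    (distL one X Y).hom ≫ addHom (lu X).hom (lu Y).hom = (lu (add X Y)).hom
  ann3r : ∀ (X Y : C),
    (distR X Y one).hom ≫ addHom (ru X).hom (ru Y).hom = (ru (add X Y)).hom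

namespace AnnCat

variable {C : Type u} [Groupoid.{v} C] (S : AnnCat C)

/-- The defining property of `L̂^A : A ⊗ 0 → 0`:
`g_{A⊗X} ∘ (L̂^A ⊕ id_{A⊗X}) ∘ 𝔏_{A,0,X} = id_A ⊗ g_X` for all `X`. -/
def IsLhat (A : C) (f : S.mul A S.zero ⟶ S.zero) : Prop :=
  ∀ X : C, (S.distL A S.zero X).hom ≫ S.addHom f (𝟙 (S.mul A X)) ≫ (S.gl (S.mul A X)).hom
    = S.mulHom (𝟙 A) (S.gl X).hom

/-- The defining property of `R̂^A : 0 ⊗ A → 0`: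
`g_{X⊗A} ∘ (R̂^A ⊕ id_{X⊗A}) ∘ ℜ_{0,X,A} = g_X ⊗ id_A` for all `X`. -/
def IsRhat (A : C) (f : S.mul S.zero A ⟶ S.zero) : Prop :=
  ∀ X : C, (S.distR S.zero X A).hom ≫ S.addHom f (𝟙 (S.mul X A)) ≫ (S.gl (S.mul X A)).hom
    = S.mulHom (S.gl X).hom (𝟙 A)

end AnnCat

/-- `− ⊕ φ` is faithful for `φ : Y ⟶ 0`. -/
theorem AnnCat.addHom_cancel {C : Type u} [Groupoid.{v} C] (S : AnnCat C)
    {X Z Y : C} (f g : X ⟶ Z) (e : Y ≅ S.zero)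
    (h : S.addHom f e.hom = S.addHom g e.hom) : f = g := by
  have h2 : ∀ k : X ⟶ Z, S.addHom k (𝟙 S.zero) = S.addHom (𝟙 X) e.inv ≫ S.addHom k e.hom := by
    intro k
    rw [← S.addHom_comp]; simp
  have h3 : S.addHom f (𝟙 S.zero) = S.addHom g (𝟙 S.zero) := by rw [h2, h2, h]
  rw [← cancel_epi (S.dr X).hom, ← S.dr_natural, ← S.dr_natural, h3]

/-- `L̂^1 = l_0` and `R̂^1 = r_0` (axioms K14 and K13). -/
theorem ann_Lhat_one_Rhat_one {C : Type u} [Groupoid.{v} C] (S : AnnCat C)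
    (L1 : S.mul S.one S.zero ≅ S.zero) (hL1 : S.IsLhat S.one L1.hom)
    (R1 : S.mul S.zero S.one ≅ S.zero) (hR1 : S.IsRhat S.one R1.hom) :
    L1.hom = (S.lu S.zero).hom ∧ R1.hom = (S.ru S.zero).hom := by
  have key : ∀ {M : C} (f : M ⟶ S.zero) (e : M ≅ S.zero),
      S.addHom f (𝟙 M) ≫ (S.gl M).hom ≫ e.hom = S.addHom f e.hom ≫ (S.gl S.zero).hom := by
    intro M f e
    rw [← S.gl_natural, ← Category.assoc, ← S.addHom_comp]; simp
  constructor
  · apply S.addHom_cancel _ _ (S.lu S.zero)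
    have h := congrArg (· ≫ (S.lu S.zero).hom) (hL1 S.zero)
    simp only [Category.assoc] at h
    rw [key, S.lu_natural, ← S.ann3l, Category.assoc, cancel_epi] at h
    exact (cancel_mono _).1 h
  · apply S.addHom_cancel _ _ (S.ru S.zero)
    have h := congrArg (· ≫ (S.ru S.zero).hom) (hR1 S.zero)
    simp only [Category.assoc] at h
    rw [key, S.ru_natural, ← S.ann3r, Category.assoc, cancel_epi] at h
    exact (cancel_mono _).1 h
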